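/- arXiv:1002.1139 — 6 statements merged into one kernel-verified Lean document; each statement's English description precedes it below -/
import Mathlib

section
/- Let C = (φ,Φ) be a skew-evolution semiflow on X × V and P₁, P₂ projectors compatible with C. If C is Barreira–Valls exponentially dichotomic with respect to P₁, P₂ with constants N ≥ 1 and α₁, α₂, β₁, β₂ > 0 satisfying α₁ ≥ β₁ and α₂ ≥ β₂, then C is Barreira–Valls polynomially dichotomic with respect to P₁, P₂; in fact ‖Φ₁(t,s,x)v‖ ≤ N t^{−α₁} s^{β₁} ‖P₁(x)v‖ and ‖P₂(x)v‖ ≤ N t^{−α₂} s^{β₂} ‖Φ₂(t,s,x)v‖ for all t ≥ s ≥ 1, x ∈ X, v ∈ V. -/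
open Real MeasureTheory

section SkewEvolution

variable {X : Type*} [MetricSpace X] {V : Type*} [NormedAddCommGroup V] [NormedSpace ℝ V]

/-- `φ : T × X → X` is an evolution semiflow (`φ t s x` for `t ≥ s ≥ 0`). -/
def IsEvolutionSemiflow (φ : ℝ → ℝ → X → X) : Prop :=
  (∀ t x, 0 ≤ t → φ t t x = x) ∧
  ∀ t s t₀ x, 0 ≤ t₀ → t₀ ≤ s → s ≤ t → φ t s (φ s t₀ x) = φ t t₀ x

/-- `Φ : T × X → B(V)` is an evolution cocycle over the evolution semiflow `φ`. -/
def IsEvolutionCocycle (φ : ℝ → ℝ → X → X) (Φ : ℝ → ℝ → X → (V →L[ℝ] V)) : Prop :=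
  (∀ t x, 0 ≤ t → Φ t t x = ContinuousLinearMap.id ℝ V) ∧
  ∀ t s t₀ x, 0 ≤ t₀ → t₀ ≤ s → s ≤ t →
    (Φ t s (φ s t₀ x)).comp (Φ s t₀ x) = Φ t t₀ x

/-- `C = (φ, Φ)` is a skew-evolution semiflow on `X × V`. -/
def IsSkewEvolutionSemiflow (φ : ℝ → ℝ → X → X) (Φ : ℝ → ℝ → X → (V →L[ℝ] V)) : Prop :=
  IsEvolutionSemiflow φ ∧ IsEvolutionCocycle φ Φ

/-- A projector on `X × V`: each `P x` is a bounded linear projection and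
`(x, v) ↦ P x v` is continuous. -/
def IsProjector (P : X → (V →L[ℝ] V)) : Prop :=
  (∀ x, (P x).comp (P x) = P x) ∧ Continuous fun p : X × V => P p.1 p.2

/-- A projector invariant relative to the skew-evolution semiflow `C = (φ, Φ)`. -/
def IsInvariantProjector (φ : ℝ → ℝ → X → X) (Φ : ℝ → ℝ → X → (V →L[ℝ] V))
    (P : X → (V →L[ℝ] V)) : Prop :=
  IsProjector P ∧
  ∀ t s x, 0 ≤ s → s ≤ t → (P (φ t s x)).comp (Φ t s x) = (Φ t s x).comp (P x)

/-- Projectors `P₁, P₂` compatible with `C = (φ, Φ)`: `P₂ x = I - P₁ x` and both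
are invariant relative to `C`. -/
def CompatibleProjectors (φ : ℝ → ℝ → X → X) (Φ : ℝ → ℝ → X → (V →L[ℝ] V))
    (P₁ P₂ : X → (V →L[ℝ] V)) : Prop :=
  (∀ x, P₂ x = ContinuousLinearMap.id ℝ V - P₁ x) ∧
  IsInvariantProjector φ Φ P₁ ∧ IsInvariantProjector φ Φ P₂

/-- `C` has exponential growth. -/
def HasExpGrowth (Φ : ℝ → ℝ → X → (V →L[ℝ] V)) : Prop :=
  ∃ M ω : ℝ → ℝ, (∀ s, 0 ≤ s → 0 < M s) ∧ (∀ s, 0 ≤ s → 0 < ω s) ∧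
    ∀ t s t₀ (x : X) (v : V), 0 ≤ t₀ → t₀ ≤ s → s ≤ t →
      ‖Φ t t₀ x v‖ ≤ M s * Real.exp (ω s * (t - s)) * ‖Φ s t₀ x v‖

/-- `C` has exponential decay. -/
def HasExpDecay (Φ : ℝ → ℝ → X → (V →L[ℝ] V)) : Prop :=
  ∃ M ω : ℝ → ℝ, (∀ t, 0 ≤ t → 0 < M t) ∧ (∀ t, 0 ≤ t → 0 < ω t) ∧
    ∀ t s t₀ (x : X) (v : V), 0 ≤ t₀ → t₀ ≤ s → s ≤ t →
      ‖Φ s t₀ x v‖ ≤ M t * Real.exp (ω t * (t - s)) * ‖Φ t t₀ x v‖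

/-- `C` has bounded exponential growth. -/
def HasBoundedExpGrowth (Φ : ℝ → ℝ → X → (V →L[ℝ] V)) : Prop :=
  ∃ M ω : ℝ, 1 ≤ M ∧ 0 < ω ∧
    ∀ t s (x : X), 0 ≤ s → s ≤ t → ‖Φ t s x‖ ≤ M * Real.exp (ω * (t - s))

/-- `C` has uniform exponential decay. -/
def HasUnifExpDecay (Φ : ℝ → ℝ → X → (V →L[ℝ] V)) : Prop :=
  ∃ M ω : ℝ, 1 ≤ M ∧ 0 < ω ∧
    ∀ t s t₀ (x : X) (v : V), 0 ≤ t₀ → t₀ ≤ s → s ≤ t →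
      ‖Φ s t₀ x v‖ ≤ M * Real.exp (ω * (t - s)) * ‖Φ t t₀ x v‖

/-- `C` is strongly measurable: `s ↦ ‖Φ(s, t₀, x) v‖` is measurable on `[t₀, ∞)`. -/
def IsStronglyMeasurableSES (Φ : ℝ → ℝ → X → (V →L[ℝ] V)) : Prop :=
  ∀ t₀ (x : X) (v : V), 0 ≤ t₀ →
    Measurable fun s : Set.Ici t₀ => ‖Φ (s : ℝ) t₀ x v‖

/-- Uniform exponential dichotomy with respect to compatible projectors `P₁, P₂`. -/
def IsUnifExpDichotomic (Φ : ℝ → ℝ → X → (V →L[ℝ] V))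
    (P₁ P₂ : X → (V →L[ℝ] V)) : Prop :=
  ∃ N₁ N₂ ν₁ ν₂ : ℝ, 1 ≤ N₁ ∧ 1 ≤ N₂ ∧ 0 < ν₁ ∧ 0 < ν₂ ∧
    ∀ t s t₀ (x : X) (v : V), 0 ≤ t₀ → t₀ ≤ s → s ≤ t →
      Real.exp (ν₁ * (t - s)) * ‖Φ t t₀ x (P₁ x v)‖ ≤ N₁ * ‖Φ s t₀ x (P₁ x v)‖ ∧
      Real.exp (ν₂ * (t - s)) * ‖Φ s t₀ x (P₂ x v)‖ ≤ N₂ * ‖Φ t t₀ x (P₂ x v)‖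

/-- Barreira-Valls exponential dichotomy with respect to compatible projectors `P₁, P₂`. -/
def IsBVExpDichotomic (Φ : ℝ → ℝ → X → (V →L[ℝ] V))
    (P₁ P₂ : X → (V →L[ℝ] V)) : Prop :=
  ∃ N α₁ α₂ β₁ β₂ : ℝ, 1 ≤ N ∧ 0 < α₁ ∧ 0 < α₂ ∧ 0 < β₁ ∧ 0 < β₂ ∧
    ∀ t s t₀ (x : X) (v : V), 0 ≤ t₀ → t₀ ≤ s → s ≤ t →
      ‖Φ t t₀ x (P₁ x v)‖ ≤ N * Real.exp (-α₁ * t) * Real.exp (β₁ * s) * ‖Φ s t₀ x (P₁ x v)‖ ∧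
      ‖Φ s t₀ x (P₂ x v)‖ ≤ N * Real.exp (-α₂ * t) * Real.exp (β₂ * s) * ‖Φ t t₀ x (P₂ x v)‖

/-- (Nonuniform) exponential dichotomy with respect to compatible projectors `P₁, P₂`. -/
def IsExpDichotomic (Φ : ℝ → ℝ → X → (V →L[ℝ] V))
    (P₁ P₂ : X → (V →L[ℝ] V)) : Prop :=
  ∃ (N₁ N₂ : ℝ → ℝ) (ν₁ ν₂ : ℝ), (∀ s, 0 ≤ s → 0 < N₁ s) ∧ (∀ s, 0 ≤ s → 0 < N₂ s) ∧
    0 < ν₁ ∧ 0 < ν₂ ∧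
    ∀ t s t₀ (x : X) (v : V), 0 ≤ t₀ → t₀ ≤ s → s ≤ t →
      ‖Φ t t₀ x (P₁ x v)‖ ≤ N₁ s * Real.exp (-ν₁ * t) * ‖Φ s t₀ x (P₁ x v)‖ ∧
      ‖Φ s t₀ x (P₂ x v)‖ ≤ N₂ s * Real.exp (-ν₂ * t) * ‖Φ t t₀ x (P₂ x v)‖

/-- Uniform polynomial dichotomy with respect to compatible projectors `P₁, P₂`. -/
def IsUnifPolyDichotomic (Φ : ℝ → ℝ → X → (V →L[ℝ] V))
    (P₁ P₂ : X → (V →L[ℝ] V)) : Prop :=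
  ∃ N α₁ α₂ : ℝ, 1 ≤ N ∧ 0 < α₁ ∧ 0 < α₂ ∧
    ∀ t s (x : X) (v : V), 1 ≤ s → s ≤ t →
      ‖Φ t s x (P₁ x v)‖ ≤ N * t ^ (-α₁) * s ^ α₁ * ‖P₁ x v‖ ∧
      ‖P₂ x v‖ ≤ N * t ^ (-α₂) * s ^ α₂ * ‖Φ t s x (P₂ x v)‖

/-- Barreira-Valls polynomial dichotomy with respect to compatible projectors `P₁, P₂`. -/
def IsBVPolyDichotomic (Φ : ℝ → ℝ → X → (V →L[ℝ] V))
    (P₁ P₂ : X → (V →L[ℝ] V)) : Prop :=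
  ∃ N α₁ α₂ β₁ β₂ : ℝ, 1 ≤ N ∧ 0 < α₁ ∧ 0 < α₂ ∧ 0 < β₁ ∧ 0 < β₂ ∧
    ∀ t s (x : X) (v : V), 1 ≤ s → s ≤ t →
      ‖Φ t s x (P₁ x v)‖ ≤ N * t ^ (-α₁) * s ^ β₁ * ‖P₁ x v‖ ∧
      ‖P₂ x v‖ ≤ N * t ^ (-α₂) * s ^ β₂ * ‖Φ t s x (P₂ x v)‖

/-- (Nonuniform) polynomial dichotomy with respect to compatible projectors `P₁, P₂`. -/
def IsPolyDichotomic (Φ : ℝ → ℝ → X → (V →L[ℝ] V))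
    (P₁ P₂ : X → (V →L[ℝ] V)) : Prop :=
  ∃ (N : ℝ → ℝ) (α₁ α₂ : ℝ), (∀ s, 0 ≤ s → 1 ≤ N s) ∧ 0 < α₁ ∧ 0 < α₂ ∧
    ∀ t s (x : X) (v : V), 1 ≤ s → s ≤ t →
      ‖Φ t s x (P₁ x v)‖ ≤ N s * t ^ (-α₁) * ‖P₁ x v‖ ∧
      ‖P₂ x v‖ ≤ N s * t ^ (-α₂) * ‖Φ t s x (P₂ x v)‖

end SkewEvolution

variable {X : Type*} [MetricSpace X] {V : Type*} [NormedAddCommGroup V] [NormedSpace ℝ V]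

theorem bv_aux {α β t s : ℝ} (hβ : 0 < β) (h : β ≤ α) (hs : 1 ≤ s) (hst : s ≤ t) :
    Real.exp (-α * t) * Real.exp (β * s) ≤ t ^ (-α) * s ^ β := by
  have hs0 : 0 < s := by linarith
  have ht0 : 0 < t := by linarith
  rw [Real.rpow_def_of_pos ht0, Real.rpow_def_of_pos hs0, ← Real.exp_add, ← Real.exp_add]
  apply Real.exp_le_exp.mpr
  have h1 : Real.log t - Real.log s ≤ t - s := by
    rw [← Real.log_div ht0.ne' hs0.ne']
    have h2 := Real.log_le_sub_one_of_pos (div_pos ht0 hs0)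
    have h3 : t / s - 1 ≤ t - s := by
      rw [div_sub_one hs0.ne']
      exact div_le_self (by linarith) hs
    linarith
  have h4 := Real.log_le_sub_one_of_pos ht0
  have h5 := mul_le_mul_of_nonneg_left h1 hβ.le
  have h6 : 0 ≤ (α - β) * (t - Real.log t) := mul_nonneg (by linarith) (by linarith)
  nlinarith

/-- a Barreira-Valls exponentially dichotomic skew-evolution semiflow with
`α₁ ≥ β₁` and `α₂ ≥ β₂` is Barreira-Valls polynomially dichotomic; in fact the polynomial
estimates hold with the same constants. -/
theorem bvExpDichotomic_isBVPolyDichotomic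
    (φ : ℝ → ℝ → X → X) (Φ : ℝ → ℝ → X → (V →L[ℝ] V))
    (hC : IsSkewEvolutionSemiflow φ Φ)
    (P₁ P₂ : X → (V →L[ℝ] V)) (hP : CompatibleProjectors φ Φ P₁ P₂)
    (N α₁ α₂ β₁ β₂ : ℝ) (hN : 1 ≤ N) (hα₁ : 0 < α₁) (hα₂ : 0 < α₂)
    (hβ₁ : 0 < β₁) (hβ₂ : 0 < β₂) (h₁₁ : β₁ ≤ α₁) (h₂₂ : β₂ ≤ α₂)
    (hBV : ∀ t s t₀ (x : X) (v : V), 0 ≤ t₀ → t₀ ≤ s → s ≤ t →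
      ‖Φ t t₀ x (P₁ x v)‖ ≤ N * Real.exp (-α₁ * t) * Real.exp (β₁ * s) * ‖Φ s t₀ x (P₁ x v)‖ ∧
      ‖Φ s t₀ x (P₂ x v)‖ ≤ N * Real.exp (-α₂ * t) * Real.exp (β₂ * s) * ‖Φ t t₀ x (P₂ x v)‖) :
    IsBVPolyDichotomic Φ P₁ P₂ ∧
      ∀ t s (x : X) (v : V), 1 ≤ s → s ≤ t →
        ‖Φ t s x (P₁ x v)‖ ≤ N * t ^ (-α₁) * s ^ β₁ * ‖P₁ x v‖ ∧
        ‖P₂ x v‖ ≤ N * t ^ (-α₂) * s ^ β₂ * ‖Φ t s x (P₂ x v)‖ := by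
  have key : ∀ t s (x : X) (v : V), 1 ≤ s → s ≤ t →
        ‖Φ t s x (P₁ x v)‖ ≤ N * t ^ (-α₁) * s ^ β₁ * ‖P₁ x v‖ ∧
        ‖P₂ x v‖ ≤ N * t ^ (-α₂) * s ^ β₂ * ‖Φ t s x (P₂ x v)‖ := by
    intro t s x v hs hst
    have hs0 : 0 ≤ s := by linarith
    have hN0 : 0 ≤ N := by linarith
    obtain ⟨h1, h2⟩ := hBV t s s x v hs0 le_rfl hst
    rw [hC.2.1 s x hs0, ContinuousLinearMap.id_apply] at h1 h2
    rw [mul_assoc N] at h1 h2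
    rw [mul_assoc N, mul_assoc N (t ^ (-α₂))]
    exact ⟨h1.trans (mul_le_mul_of_nonneg_right
        (mul_le_mul_of_nonneg_left (bv_aux hβ₁ h₁₁ hs hst) hN0) (norm_nonneg _)),
      h2.trans (mul_le_mul_of_nonneg_right
        (mul_le_mul_of_nonneg_left (bv_aux hβ₂ h₂₂ hs hst) hN0) (norm_nonneg _))⟩
  exact ⟨⟨N, α₁, α₂, β₁, β₂, hN, hα₁, hα₂, hβ₁, hβ₂, key⟩, key⟩
end

section
/- Let C = (φ,Φ) be a skew-evolution semiflow on X × V and P₁, P₂ projectors compatible with C. If C is exponentially dichotomic with respect to P₁, P₂, then C is polynomially dichotomic with respect to P₁, P₂. -/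
open Real MeasureTheory

variable {X : Type*} [MetricSpace X] {V : Type*} [NormedAddCommGroup V] [NormedSpace ℝ V]

/-- an exponentially dichotomic skew-evolution semiflow is polynomially
dichotomic. -/
theorem expDichotomic_isPolyDichotomic
    (φ : ℝ → ℝ → X → X) (Φ : ℝ → ℝ → X → (V →L[ℝ] V))
    (hC : IsSkewEvolutionSemiflow φ Φ)
    (P₁ P₂ : X → (V →L[ℝ] V)) (hP : CompatibleProjectors φ Φ P₁ P₂)
    (h : IsExpDichotomic Φ P₁ P₂) :
    IsPolyDichotomic Φ P₁ P₂ := by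
  obtain ⟨N₁, N₂, ν₁, ν₂, hN₁, hN₂, hν₁, hν₂, H⟩ := h
  have key : ∀ ν t : ℝ, 0 < ν → 1 ≤ t → Real.exp (-ν * t) ≤ t ^ (-ν) := by
    intro ν t hν ht
    rw [Real.rpow_def_of_pos (by linarith)]
    apply Real.exp_le_exp.mpr
    have := Real.log_le_sub_one_of_pos (show (0:ℝ) < t by linarith)
    nlinarith
  refine ⟨fun s => 1 + |N₁ s| + |N₂ s|, ν₁, ν₂, ?_, hν₁, hν₂, ?_⟩
  · intro s _
    have h1 := abs_nonneg (N₁ s)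
    have h2 := abs_nonneg (N₂ s)
    show 1 ≤ 1 + |N₁ s| + |N₂ s|
    linarith
  · intro t s x v hs hst
    have hs0 : 0 ≤ s := by linarith
    obtain ⟨h1, h2⟩ := H t s s x v hs0 le_rfl hst
    have hid : ∀ w, Φ s s x w = w := by
      intro w
      rw [hC.2.1 s x hs0]
      rfl
    rw [hid] at h1 h2
    have a1 := abs_nonneg (N₁ s)
    have a2 := abs_nonneg (N₂ s)
    have b1 := le_abs_self (N₁ s)
    have b2 := le_abs_self (N₂ s)
    have k1 := key ν₁ t hν₁ (hs.trans hst)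
    have k2 := key ν₂ t hν₂ (hs.trans hst)
    have c1 : N₁ s ≤ 1 + |N₁ s| + |N₂ s| := by linarith
    have c2 : N₂ s ≤ 1 + |N₁ s| + |N₂ s| := by linarith
    constructor
    · refine h1.trans (mul_le_mul_of_nonneg_right ?_ (norm_nonneg _))
      exact mul_le_mul c1 k1 (Real.exp_pos _).le (by positivity)
    · refine h2.trans (mul_le_mul_of_nonneg_right ?_ (norm_nonneg _))
      exact mul_le_mul c2 k2 (Real.exp_pos _).le (by positivity)
end

section
/- Let C = (φ,Φ) be a strongly measurable skew-evolution semiflow on X × V and P₁, P₂ projectors compatible with C. If C is exponentially dichotomic with respect to P₁, P₂, then there exist a constant γ > 0 and a function D : [0,∞) → [1,∞) such that ∫_s^∞ e^{γ(τ−s)} ‖Φ₁(τ,s,x)v‖ dτ ≤ D(s) ‖P₁(x)v‖ for all s ≥ 0, x ∈ X and v ∈ V. -/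
open Real MeasureTheory

variable {X : Type*} [MetricSpace X] {V : Type*} [NormedAddCommGroup V] [NormedSpace ℝ V]

/-- if a strongly measurable skew-evolution semiflow is exponentially
dichotomic, then the integral condition (i) of the main theorem holds. -/
theorem expDichotomic_integral_condition_one
    (φ : ℝ → ℝ → X → X) (Φ : ℝ → ℝ → X → (V →L[ℝ] V))
    (hC : IsSkewEvolutionSemiflow φ Φ) (hM : IsStronglyMeasurableSES Φ)
    (P₁ P₂ : X → (V →L[ℝ] V)) (hP : CompatibleProjectors φ Φ P₁ P₂)
    (h : IsExpDichotomic Φ P₁ P₂) :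
    ∃ (γ : ℝ) (D : ℝ → ℝ), 0 < γ ∧ (∀ s, 0 ≤ s → 1 ≤ D s) ∧
      ∀ s (x : X) (v : V), 0 ≤ s →
        ∫⁻ τ in Set.Ioi s, ENNReal.ofReal (Real.exp (γ * (τ - s)) * ‖Φ τ s x (P₁ x v)‖) ≤
          ENNReal.ofReal (D s * ‖P₁ x v‖) := by
  obtain ⟨N₁, N₂, ν₁, ν₂, hN₁, hN₂, hν₁, hν₂, hd⟩ := h
  obtain ⟨γ, rfl⟩ : ∃ γ, ν₁ = 2 * γ := ⟨ν₁ / 2, by ring⟩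
  have hγ : 0 < γ := by linarith
  refine ⟨γ, fun s => 1 + N₁ s * Real.exp (-γ * s) * (∫ τ in Set.Ioi s, Real.exp (-γ * τ)),
    hγ, ?_, ?_⟩
  · intro s hs
    have h1 : 0 ≤ ∫ τ in Set.Ioi s, Real.exp (-γ * τ) :=
      integral_nonneg fun τ => (Real.exp_pos _).le
    have h2 := (hN₁ s hs).le
    have : 0 ≤ N₁ s * Real.exp (-γ * s) * (∫ τ in Set.Ioi s, Real.exp (-γ * τ)) := by positivity
    simpa using this
  · intro s x v hs
    have hN := (hN₁ s hs).le
    have hint : IntegrableOn (fun τ => Real.exp (-γ * τ)) (Set.Ioi s) :=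
      integrableOn_exp_mul_Ioi (by linarith) s
    calc ∫⁻ τ in Set.Ioi s, ENNReal.ofReal (Real.exp (γ * (τ - s)) * ‖Φ τ s x (P₁ x v)‖)
        ≤ ∫⁻ τ in Set.Ioi s, ENNReal.ofReal
            (N₁ s * Real.exp (-γ * s) * ‖P₁ x v‖ * Real.exp (-γ * τ)) := by
          refine setLIntegral_mono' measurableSet_Ioi fun τ hτ => ENNReal.ofReal_le_ofReal ?_
          have h1 := (hd τ s s x v hs le_rfl (le_of_lt hτ)).1
          rw [hC.2.1 s x hs, ContinuousLinearMap.id_apply] at h1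
          have h2 : Real.exp (γ * (τ - s)) * Real.exp (-(2 * γ) * τ)
              = Real.exp (-γ * s) * Real.exp (-γ * τ) := by
            rw [← Real.exp_add, ← Real.exp_add]; congr 1; ring
          calc _ ≤ Real.exp (γ * (τ - s)) * (N₁ s * Real.exp (-(2 * γ) * τ) * ‖P₁ x v‖) := by
                gcongr
            _ = N₁ s * ‖P₁ x v‖ * (Real.exp (γ * (τ - s)) * Real.exp (-(2 * γ) * τ)) := by ring
            _ = _ := by rw [h2]; ring
      _ = ENNReal.ofReal (∫ τ in Set.Ioi s,
            N₁ s * Real.exp (-γ * s) * ‖P₁ x v‖ * Real.exp (-γ * τ)) :=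
          (ofReal_integral_eq_lintegral_ofReal (hint.const_mul _)
            (Filter.Eventually.of_forall fun τ => by positivity)).symm
      _ ≤ _ := by
          refine ENNReal.ofReal_le_ofReal ?_
          rw [integral_const_mul]
          have := norm_nonneg (P₁ x v)
          nlinarith
end

section
/- Let C = (φ,Φ) be a strongly measurable skew-evolution semiflow on X × V and P₁, P₂ projectors compatible with C, such that C₁ = (φ,Φ₁) has bounded exponential growth and C₂ = (φ,Φ₂) has uniform exponential decay. Assume: (i) there exist a constant γ > 0 and a function D : [0,∞) → [1,∞) such that ∫_s^∞ e^{γ(τ−s)} ‖Φ₁(τ,s,x)v‖ dτ ≤ D(s) ‖P₁(x)v‖ for all s ≥ 0, x ∈ X, v ∈ V; (ii) there exist a constant ρ > 0 and a nondecreasing function D̃ : [0,∞) → [1,∞) such that ∫_{t₀}^t e^{ρ(t−τ)} ‖Φ₂(τ,t₀,x)v‖ dτ ≤ D̃(t₀) ‖Φ₂(t,t₀,x)v‖ for all t ≥ t₀ ≥ 0, x ∈ X, v ∈ V. Then C is exponentially dichotomic with respect to P₁, P₂. -/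
open Real MeasureTheory

variable {X : Type*} [MetricSpace X] {V : Type*} [NormedAddCommGroup V] [NormedSpace ℝ V]

lemma aux_int (g : ℝ → ℝ) (S : Set ℝ) (a c K B : ℝ) (hK : 0 < K) (hB : 0 ≤ B)
    (hS : Set.Ioc a (a + 1) ⊆ S) (hc : ∀ τ ∈ Set.Ioc a (a + 1), c ≤ K * g τ)
    (h : ∫⁻ τ in S, ENNReal.ofReal (g τ) ≤ ENNReal.ofReal B) : c ≤ K * B := by
  have h1 : ENNReal.ofReal (c / K) ≤ ENNReal.ofReal B := by
    calc ENNReal.ofReal (c / K) = ∫⁻ _ in Set.Ioc a (a + 1), ENNReal.ofReal (c / K) := by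
          simp
      _ ≤ ∫⁻ τ in Set.Ioc a (a + 1), ENNReal.ofReal (g τ) := by
          apply setLIntegral_mono' measurableSet_Ioc
          intro τ hτ
          apply ENNReal.ofReal_le_ofReal
          rw [div_le_iff₀' hK]
          exact hc τ hτ
      _ ≤ ∫⁻ τ in S, ENNReal.ofReal (g τ) := lintegral_mono_set hS
      _ ≤ _ := h
  rw [ENNReal.ofReal_le_ofReal_iff hB, div_le_iff₀' hK] at h1
  exact h1

/-- Numerical conversion. -/
lemma aux_exp (r t s A C : ℝ) (E : ℝ) (h : Real.exp (r * (t - s - 1)) * A ≤ E * C) :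
    A ≤ E * Real.exp r * Real.exp (r * s) * Real.exp (-r * t) * C := by
  have h2 : Real.exp r * Real.exp (r * s) * Real.exp (-r * t) * Real.exp (r * (t - s - 1)) = 1 := by
    rw [← Real.exp_add, ← Real.exp_add, ← Real.exp_add, Real.exp_eq_one_iff]; ring
  have h3 : 0 < Real.exp r * Real.exp (r * s) * Real.exp (-r * t) := by positivity
  calc A = Real.exp r * Real.exp (r * s) * Real.exp (-r * t) *
        (Real.exp (r * (t - s - 1)) * A) := by rw [← mul_assoc, h2, one_mul]
    _ ≤ Real.exp r * Real.exp (r * s) * Real.exp (-r * t) * (E * C) :=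
        mul_le_mul_of_nonneg_left h h3.le
    _ = _ := by ring

/-- sufficiency part of the main theorem; the integral conditions (i) and
(ii), together with bounded exponential growth of `C₁` and uniform exponential decay of
`C₂`, imply that `C` is exponentially dichotomic. -/
theorem integral_conditions_expDichotomic
    (φ : ℝ → ℝ → X → X) (Φ : ℝ → ℝ → X → (V →L[ℝ] V))
    (hC : IsSkewEvolutionSemiflow φ Φ) (hM : IsStronglyMeasurableSES Φ)
    (P₁ P₂ : X → (V →L[ℝ] V)) (hP : CompatibleProjectors φ Φ P₁ P₂)
    (hG : HasBoundedExpGrowth (fun t s x => (Φ t s x).comp (P₁ x)))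
    (hD : HasUnifExpDecay (fun t s x => (Φ t s x).comp (P₂ x)))
    (γ : ℝ) (D : ℝ → ℝ) (hγ : 0 < γ) (hD₁ : ∀ s, 0 ≤ s → 1 ≤ D s)
    (hi : ∀ s (x : X) (v : V), 0 ≤ s →
      ∫⁻ τ in Set.Ioi s, ENNReal.ofReal (Real.exp (γ * (τ - s)) * ‖Φ τ s x (P₁ x v)‖) ≤
        ENNReal.ofReal (D s * ‖P₁ x v‖))
    (ρ : ℝ) (D' : ℝ → ℝ) (hρ : 0 < ρ) (hD'₁ : ∀ u, 0 ≤ u → 1 ≤ D' u)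
    (hD'mono : ∀ a b, 0 ≤ a → a ≤ b → D' a ≤ D' b)
    (hii : ∀ t t₀ (x : X) (v : V), 0 ≤ t₀ → t₀ ≤ t →
      ∫⁻ τ in Set.Ioc t₀ t,
          ENNReal.ofReal (Real.exp (ρ * (t - τ)) * ‖Φ τ t₀ x (P₂ x v)‖) ≤
        ENNReal.ofReal (D' t₀ * ‖Φ t t₀ x (P₂ x v)‖)) :
    IsExpDichotomic Φ P₁ P₂ := by
  obtain ⟨⟨_, _⟩, _, hco⟩ := hC
  obtain ⟨_, ⟨⟨hp1, _⟩, hinv1⟩, _⟩ := hP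
  obtain ⟨M, ω, hM1, hω, hG⟩ := hG
  obtain ⟨M', ω', hM1', hω', hD⟩ := hD
  have hM0 : 0 < M := by linarith
  have hM0' : 0 < M' := by linarith
  have hG' : ∀ t s t₀ (x : X) (v : V), 0 ≤ t₀ → t₀ ≤ s → s ≤ t →
      ‖Φ t t₀ x (P₁ x v)‖ ≤ M * Real.exp (ω * (t - s)) * ‖Φ s t₀ x (P₁ x v)‖ := by
    intro t s t₀ x v h0 h1 h2
    have e1 : Φ t t₀ x (P₁ x v) = Φ t s (φ s t₀ x) (Φ s t₀ x (P₁ x v)) := by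
      rw [← hco t s t₀ x h0 h1 h2]; rfl
    have e2 : P₁ (φ s t₀ x) (Φ s t₀ x (P₁ x v)) = Φ s t₀ x (P₁ x v) := by
      have a := DFunLike.congr_fun (hinv1 s t₀ x h0 h1) (P₁ x v)
      have b := DFunLike.congr_fun (hp1 x) v
      simp only [ContinuousLinearMap.comp_apply] at a b
      rw [a, b]
    have := ((Φ t s (φ s t₀ x)).comp (P₁ (φ s t₀ x))).le_of_opNorm_le
      (hG t s (φ s t₀ x) (h0.trans h1) h2) (Φ s t₀ x (P₁ x v))
    rw [ContinuousLinearMap.comp_apply, e2, ← e1] at this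
    exact this
  have hD2 : ∀ t s t₀ (x : X) (v : V), 0 ≤ t₀ → t₀ ≤ s → s ≤ t →
      ‖Φ s t₀ x (P₂ x v)‖ ≤ M' * Real.exp (ω' * (t - s)) * ‖Φ t t₀ x (P₂ x v)‖ := hD
  refine ⟨fun s => M * Real.exp ω * D s * Real.exp γ * Real.exp (γ * s),
    fun s => M' * Real.exp ω' * D' s * Real.exp ρ * Real.exp (ρ * s), γ, ρ, ?_, ?_, hγ, hρ, ?_⟩
  · intro s hs
    have := hD₁ s hs
    positivity
  · intro s hs
    have := hD'₁ s hs
    positivity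
  intro t s t₀ x v h0 h1 h2
  have hs := h0.trans h1
  have hDs := hD₁ s hs
  have hDs' := hD'₁ s hs
  have hD0' := hD'₁ t₀ h0
  constructor
  · apply aux_exp
    rcases le_total (s + 1) t with h3 | h3
    · have e1 : ∀ τ, s ≤ τ → Φ τ s (φ s t₀ x) (P₁ (φ s t₀ x) (Φ s t₀ x v)) = Φ τ t₀ x (P₁ x v) := by
        intro τ hτ
        have a := DFunLike.congr_fun (hinv1 s t₀ x h0 h1) v
        simp only [ContinuousLinearMap.comp_apply] at a
        rw [a, ← hco τ s t₀ x h0 h1 hτ]; rfl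
      have e2 : P₁ (φ s t₀ x) (Φ s t₀ x v) = Φ s t₀ x (P₁ x v) :=
        DFunLike.congr_fun (hinv1 s t₀ x h0 h1) v
      have key := hi s (φ s t₀ x) (Φ s t₀ x v) hs
      have := aux_int _ _ (t - 1) (Real.exp (γ * (t - s - 1)) * ‖Φ t t₀ x (P₁ x v)‖)
        (M * Real.exp ω) _ (by positivity) (by positivity) ?_ ?_ key
      · rw [e2] at this
        linarith
      · intro τ hτ
        have := hτ.1
        simp only [Set.mem_Ioi]; linarith
      · intro τ hτ
        have ha := hτ.1
        have hb : τ ≤ t := by linarith [hτ.2]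
        rw [e1 τ (by linarith)]
        have g1 := hG' t τ t₀ x v h0 (by linarith) hb
        have g2 : Real.exp (ω * (t - τ)) ≤ Real.exp ω := Real.exp_le_exp.2 (by nlinarith)
        have g3 : Real.exp (γ * (t - s - 1)) ≤ Real.exp (γ * (τ - s)) :=
          Real.exp_le_exp.2 (by nlinarith)
        calc _ ≤ Real.exp (γ * (τ - s)) * (M * Real.exp ω * ‖Φ τ t₀ x (P₁ x v)‖) := by
              refine mul_le_mul g3 (g1.trans ?_) (norm_nonneg _) (Real.exp_pos _).le
              gcongr
          _ = _ := by ring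
    · have g1 := hG' t s t₀ x v h0 h1 h2
      have g2 : Real.exp (ω * (t - s)) ≤ Real.exp ω := Real.exp_le_exp.2 (by nlinarith)
      have g3 : Real.exp (γ * (t - s - 1)) ≤ 1 := Real.exp_le_one_iff.2 (by nlinarith)
      calc _ ≤ 1 * (M * Real.exp ω * ‖Φ s t₀ x (P₁ x v)‖) := by
            refine mul_le_mul g3 (g1.trans ?_) (norm_nonneg _) zero_le_one
            gcongr
        _ = M * Real.exp ω * 1 * ‖Φ s t₀ x (P₁ x v)‖ := by ring
        _ ≤ _ := by gcongr
  · apply aux_exp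
    rcases le_total (s + 1) t with h3 | h3
    · have key := hii t t₀ x v h0 (h1.trans h2)
      have := aux_int _ _ s (Real.exp (ρ * (t - s - 1)) * ‖Φ s t₀ x (P₂ x v)‖)
        (M' * Real.exp ω') _ (by positivity) (by positivity) ?_ ?_ key
      · refine this.trans ?_
        rw [← mul_assoc]
        have := hD'mono t₀ s h0 h1
        gcongr
      · intro τ hτ
        exact ⟨by linarith [hτ.1], by linarith [hτ.2]⟩
      · intro τ hτ
        have ha := hτ.1
        have hb := hτ.2
        have g1 := hD2 τ s t₀ x v h0 h1 ha.le
        have g2 : Real.exp (ω' * (τ - s)) ≤ Real.exp ω' := Real.exp_le_exp.2 (by nlinarith)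
        have g3 : Real.exp (ρ * (t - s - 1)) ≤ Real.exp (ρ * (t - τ)) :=
          Real.exp_le_exp.2 (by nlinarith)
        calc _ ≤ Real.exp (ρ * (t - τ)) * (M' * Real.exp ω' * ‖Φ τ t₀ x (P₂ x v)‖) := by
              refine mul_le_mul g3 (g1.trans ?_) (norm_nonneg _) (Real.exp_pos _).le
              gcongr
          _ = _ := by ring
    · have g1 := hD2 t s t₀ x v h0 h1 h2
      have g2 : Real.exp (ω' * (t - s)) ≤ Real.exp ω' := Real.exp_le_exp.2 (by nlinarith)
      have g3 : Real.exp (ρ * (t - s - 1)) ≤ 1 := Real.exp_le_one_iff.2 (by nlinarith)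
      calc _ ≤ 1 * (M' * Real.exp ω' * ‖Φ t t₀ x (P₂ x v)‖) := by
            refine mul_le_mul g3 (g1.trans ?_) (norm_nonneg _) zero_le_one
            gcongr
        _ = M' * Real.exp ω' * 1 * ‖Φ t t₀ x (P₂ x v)‖ := by ring
        _ ≤ _ := by gcongr
end

section
/- There exist a metric space X, a skew-evolution semiflow C = (φ,Φ) on X × ℝ² (with ℝ² normed by ‖(v₁,v₂)‖ = |v₁| + |v₂|), and projectors P₁, P₂ compatible with C, such that C is Barreira–Valls exponentially dichotomic with respect to P₁, P₂, but for every choice of constants N₁, N₂ ≥ 1 and ν₁, ν₂ > 0 the uniform exponential dichotomy estimates with respect to P₁, P₂ fail; that is, C is not uniformly exponentially dichotomic with respect to P₁, P₂. -/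
open Real MeasureTheory

/-- diagonal operator on the plane -/
noncomputable def diagOp (a b : ℝ) : WithLp 1 (ℝ × ℝ) →L[ℝ] WithLp 1 (ℝ × ℝ) :=
  ((WithLp.prodContinuousLinearEquiv 1 ℝ ℝ ℝ).symm : (ℝ × ℝ) →L[ℝ] WithLp 1 (ℝ × ℝ)).comp
    (((a • ContinuousLinearMap.id ℝ ℝ).prodMap (b • ContinuousLinearMap.id ℝ ℝ)).comp
      ((WithLp.prodContinuousLinearEquiv 1 ℝ ℝ ℝ) : WithLp 1 (ℝ × ℝ) →L[ℝ] (ℝ × ℝ)))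

theorem diagOp_apply (a b : ℝ) (v : WithLp 1 (ℝ × ℝ)) :
    diagOp a b v = WithLp.toLp 1 (a * v.fst, b * v.snd) := rfl

theorem diagOp_fst (a b : ℝ) (v : WithLp 1 (ℝ × ℝ)) : (diagOp a b v).fst = a * v.fst := rfl

theorem diagOp_snd (a b : ℝ) (v : WithLp 1 (ℝ × ℝ)) : (diagOp a b v).snd = b * v.snd := rfl

theorem diagOp_comp (a b c d : ℝ) :
    (diagOp a b).comp (diagOp c d) = diagOp (a * c) (b * d) := by
  ext v
  simp only [ContinuousLinearMap.comp_apply, diagOp_apply, mul_assoc]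
  rfl

theorem diagOp_one : diagOp 1 1 = ContinuousLinearMap.id ℝ _ := by
  ext v
  simp only [diagOp_apply, one_mul]
  rfl

theorem diagOp_sub (a b c d : ℝ) :
    diagOp a b - diagOp c d = diagOp (a - c) (b - d) := by
  ext v
  simp only [sub_apply, diagOp_apply, sub_mul]
  rfl

theorem norm_diagOp (a b : ℝ) (v : WithLp 1 (ℝ × ℝ)) :
    ‖diagOp a b v‖ = |a| * |v.fst| + |b| * |v.snd| := by
  rw [WithLp.prod_norm_eq_of_L1, diagOp_apply]
  simp [abs_mul]

/-- exponent function -/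
noncomputable def ff (t : ℝ) : ℝ := t * (2 + Real.cos t)

theorem ff_ge {t : ℝ} (h : 0 ≤ t) : t ≤ ff t := by
  unfold ff; nlinarith [Real.neg_one_le_cos t]

theorem ff_le {t : ℝ} (h : 0 ≤ t) : ff t ≤ 3 * t := by
  unfold ff; nlinarith [Real.cos_le_one t]

theorem diag_isInvariant (a b : ℝ) (ha : a * a = a) (hb : b * b = b) :
    IsInvariantProjector (X := Unit) (fun _ _ x => x)
      (fun t s _ => diagOp (Real.exp (ff s - ff t)) (Real.exp (ff t - ff s)))
      (fun _ => diagOp a b) := by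
  refine ⟨⟨fun _ => ?_, ?_⟩, fun t s x _ _ => ?_⟩
  · rw [diagOp_comp, ha, hb]
  · exact (diagOp a b).continuous.comp continuous_snd
  · simp only [diagOp_comp, mul_comm]

/-- there is a skew-evolution semiflow on `X × ℝ²` (with the `ℓ¹` norm) that is Barreira-Valls exponentially dichotomic but not uniformly exponentially dichotomic. -/
theorem exists_bvExpDichotomic_not_unifExpDichotomic :
    ∃ (X : Type) (_ : MetricSpace X)
      (φ : ℝ → ℝ → X → X)
      (Φ : ℝ → ℝ → X → (WithLp 1 (ℝ × ℝ) →L[ℝ] WithLp 1 (ℝ × ℝ)))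
      (P₁ P₂ : X → (WithLp 1 (ℝ × ℝ) →L[ℝ] WithLp 1 (ℝ × ℝ))),
      IsSkewEvolutionSemiflow φ Φ ∧ CompatibleProjectors φ Φ P₁ P₂ ∧
      IsBVExpDichotomic Φ P₁ P₂ ∧ ¬ IsUnifExpDichotomic Φ P₁ P₂ := by
  refine ⟨Unit, inferInstance, fun _ _ x => x,
    fun t s _ => diagOp (Real.exp (ff s - ff t)) (Real.exp (ff t - ff s)),
    fun _ => diagOp 1 0, fun _ => diagOp 0 1, ⟨⟨?_, ?_⟩, ?_, ?_⟩, ⟨?_, ?_, ?_⟩, ?_, ?_⟩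
  · intros; rfl
  · intros; rfl
  · intro t _ _
    simp [diagOp_one]
  · intro t s t₀ _ _ _ _
    simp only [diagOp_comp, ← Real.exp_add]
    congr 2 <;> ring
  · intro _
    rw [← diagOp_one, diagOp_sub]
    norm_num
  · exact diag_isInvariant 1 0 (by norm_num) (by norm_num)
  · exact diag_isInvariant 0 1 (by norm_num) (by norm_num)
  · refine ⟨1, 1, 1, 3, 3, le_rfl, one_pos, one_pos, by norm_num, by norm_num, ?_⟩
    intro t s t₀ _ v h0 h1 h2
    have hs := ff_le (h0.trans h1)
    have ht := ff_ge (h0.trans (h1.trans h2))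
    simp only [norm_diagOp, diagOp_fst, diagOp_snd, Real.abs_exp, one_mul, zero_mul, abs_zero, mul_zero,
      add_zero, zero_add, ← mul_assoc, ← Real.exp_add]
    constructor <;> gcongr <;> linarith
  · rintro ⟨N₁, N₂, ν₁, ν₂, hN, -, hν, -, H⟩
    obtain ⟨n, hn⟩ := exists_nat_gt N₁
    have hpi := Real.pi_gt_three
    have hn1 : (1 : ℝ) ≤ n := by
      have : (0 : ℝ) < n := by linarith
      exact_mod_cast this
    have hs0 : (0 : ℝ) ≤ n * (2 * π) := by positivity
    have h := (H (n * (2 * π) + π) (n * (2 * π)) (n * (2 * π)) () (WithLp.toLp 1 (1, 0)) hs0 le_rfl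
      (by linarith)).1
    have e1 : ff (n * (2 * π) + π) = n * (2 * π) + π := by
      unfold ff
      rw [add_comm _ π, Real.cos_add_nat_mul_two_pi, Real.cos_pi]; ring
    have e2 : ff (n * (2 * π)) = 3 * (n * (2 * π)) := by
      unfold ff
      rw [Real.cos_nat_mul_two_pi]; ring
    have e3 : (WithLp.toLp 1 ((1 : ℝ), (0 : ℝ))).fst = 1 := rfl
    simp only [norm_diagOp, diagOp_fst, diagOp_snd, e3, Real.abs_exp, one_mul, zero_mul, abs_zero,
      mul_zero, add_zero, abs_one, mul_one, ← Real.exp_add, e1, e2, sub_self, Real.exp_zero] at h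
    have h3 := Real.add_one_le_exp (ν₁ * (n * (2 * π) + π - n * (2 * π)) +
      (3 * (n * (2 * π)) - (n * (2 * π) + π)))
    have h4 : 0 < ν₁ * π := by positivity
    nlinarith
end

section
/- There exist a metric space X, a skew-evolution semiflow C = (φ,Φ) on X × ℝ² (with ℝ² normed by ‖(v₁,v₂)‖ = |v₁| + |v₂|), and projectors P₁, P₂ compatible with C, such that C is polynomially dichotomic with respect to P₁, P₂, but for every choice of functions N₁, N₂ : [0,∞) → (0,∞) and constants ν₁, ν₂ > 0 the exponential dichotomy estimates with respect to P₁, P₂ fail; that is, C is not exponentially dichotomic with respect to P₁, P₂. -/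
open Real MeasureTheory

noncomputable def diagD (a b : ℝ) : WithLp 1 (ℝ × ℝ) →L[ℝ] WithLp 1 (ℝ × ℝ) :=
  ((WithLp.prodContinuousLinearEquiv 1 ℝ ℝ ℝ).symm.toContinuousLinearMap.comp
    ((a • ContinuousLinearMap.id ℝ ℝ).prodMap (b • ContinuousLinearMap.id ℝ ℝ))).comp
    (WithLp.prodContinuousLinearEquiv 1 ℝ ℝ ℝ).toContinuousLinearMap

theorem diagD_apply (a b : ℝ) (v : WithLp 1 (ℝ × ℝ)) :
    diagD a b v = WithLp.toLp 1 (a * v.fst, b * v.snd) := rfl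

theorem diagD_comp (a b c d : ℝ) :
    (diagD a b).comp (diagD c d) = diagD (a * c) (b * d) := by
  ext v <;> simp [diagD_apply, mul_assoc]

theorem diagD_one : diagD 1 1 = ContinuousLinearMap.id ℝ _ := by
  ext v
  apply (WithLp.equiv 1 (ℝ × ℝ)).injective
  ext <;> simp [diagD_apply]

theorem diagD_sub : diagD 0 1 = ContinuousLinearMap.id ℝ _ - diagD 1 0 := by
  ext v
  apply (WithLp.equiv 1 (ℝ × ℝ)).injective
  ext <;> simp [diagD_apply]

theorem diagD_norm (a b : ℝ) (v : WithLp 1 (ℝ × ℝ)) :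
    ‖diagD a b v‖ = |a| * |v.fst| + |b| * |v.snd| := by
  rw [diagD_apply, WithLp.prod_norm_eq_of_L1]
  simp [abs_mul]

theorem diagD_app_app (a b c d : ℝ) (v : WithLp 1 (ℝ × ℝ)) :
    diagD a b (diagD c d v) = diagD (a * c) (b * d) v := by
  rw [← diagD_comp]; rfl

/-- there is a skew-evolution semiflow on `X × ℝ²` (with the `ℓ¹` norm) that is polynomially dichotomic but not exponentially dichotomic. -/
theorem exists_polyDichotomic_not_expDichotomic :
    ∃ (X : Type) (_ : MetricSpace X)
      (φ : ℝ → ℝ → X → X)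
      (Φ : ℝ → ℝ → X → (WithLp 1 (ℝ × ℝ) →L[ℝ] WithLp 1 (ℝ × ℝ)))
      (P₁ P₂ : X → (WithLp 1 (ℝ × ℝ) →L[ℝ] WithLp 1 (ℝ × ℝ))),
      IsSkewEvolutionSemiflow φ Φ ∧ CompatibleProjectors φ Φ P₁ P₂ ∧
      IsPolyDichotomic Φ P₁ P₂ ∧ ¬ IsExpDichotomic Φ P₁ P₂ := by
  refine ⟨Unit, inferInstance, fun _ _ x => x,
    fun t s _ => diagD ((s + 1) / (t + 1)) ((t + 1) / (s + 1)),
    fun _ => diagD 1 0, fun _ => diagD 0 1, ⟨⟨?_, ?_⟩, ?_, ?_⟩, ⟨?_, ⟨⟨?_, ?_⟩, ?_⟩, ⟨?_, ?_⟩, ?_⟩, ?_, ?_⟩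
  · intros; rfl
  · intros; rfl
  · intro t x ht
    have : t + 1 ≠ 0 := by positivity
    simp only [div_self this, diagD_one]
  · intro t s t₀ x h0 h1 h2
    have a0 : t₀ + 1 ≠ 0 := by linarith
    have a1 : s + 1 ≠ 0 := by linarith
    have a2 : t + 1 ≠ 0 := by linarith
    simp only [diagD_comp]
    congr 1 <;> field_simp
  · intro x; exact diagD_sub
  · intro x; simp [diagD_comp]
  · exact (diagD 1 0).continuous.comp continuous_snd
  · intros; simp [diagD_comp]
  · intro x; simp [diagD_comp]
  · exact (diagD 0 1).continuous.comp continuous_snd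
  · intros; simp [diagD_comp]
  · refine ⟨fun s => s + 1, 1, 1, fun s hs => by linarith, one_pos, one_pos, ?_⟩
    intro t s x v hs hst
    have a1 : 0 < s + 1 := by linarith
    have a2 : 0 < t + 1 := by linarith
    have a3 : 0 < t := by linarith
    simp only [diagD_app_app, diagD_norm, Real.rpow_neg_one, mul_zero, mul_one, abs_zero,
      zero_mul, add_zero, zero_add, abs_one, one_mul, abs_div, abs_of_pos a1, abs_of_pos a2]
    constructor
    · refine mul_le_mul_of_nonneg_right ?_ (abs_nonneg _)
      rw [← div_eq_mul_inv]
      exact div_le_div_of_nonneg_left a1.le a3 (by linarith)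
    · rw [← mul_assoc]
      refine le_mul_of_one_le_left (abs_nonneg _) ?_
      have : (s + 1) * t⁻¹ * ((t + 1) / (s + 1)) = (t + 1) / t := by field_simp
      rw [this, le_div_iff₀ a3]
      linarith
  · rintro ⟨N₁, N₂, ν₁, ν₂, h1, -, hν, -, h⟩
    have hN := h1 0 le_rfl
    set N := N₁ 0 with hNdef
    set t : ℝ := 1 + 4 * N / ν₁ ^ 2 with ht
    have hq : 0 < 4 * N / ν₁ ^ 2 := by positivity
    have ht1 : 1 ≤ t := by linarith
    have a2 : 0 < t + 1 := by linarith
    have key := (h t 0 0 () (WithLp.toLp 1 (1, 1)) le_rfl le_rfl (by linarith)).1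
    simp only [diagD_app_app, diagD_norm, mul_zero, mul_one, abs_zero, zero_mul, add_zero,
      zero_add, abs_one, abs_div, WithLp.toLp_fst, abs_of_pos a2, div_one, one_mul] at key
    rw [← hNdef, neg_mul, Real.exp_neg, ← div_eq_mul_inv,
      div_le_div_iff₀ a2 (Real.exp_pos _)] at key
    have hexp := Real.quadratic_le_exp_of_nonneg (x := ν₁ * t) (by positivity)
    have e : ν₁ ^ 2 * t = ν₁ ^ 2 + 4 * N := by rw [ht]; field_simp
    have e2 : (ν₁ * t) ^ 2 = (ν₁ ^ 2 + 4 * N) * t := by rw [← e]; ring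
    rw [e2] at hexp
    have p1 : 0 < ν₁ * t := by positivity
    have p2 : 0 < ν₁ ^ 2 * t := by positivity
    nlinarith
end
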